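/- Let k be a finite field of characteristic p ≠ 2, let n ≥ 2 and let r, s ≥ 0 be integers with r + s = n. Let R be an algebraically closed field of characteristic different from p, let ρ be a cuspidal irreducible R-representation of GL_n(k), and let χ be a character (one-dimensional R-representation) of the block-diagonal subgroup M = GL_r(k) × GL_s(k) of GL_n(k). If Hom_M(ρ, χ) ≠ 0, then r = s. -/

import Mathlib

open Matrix

section InvariantForms

variable {R : Type} [CommRing R] {G : Type} [Monoid G] {V : Type} [AddCommGroup V] [Module R V]

/-- The space of `H`-invariant `R`-linear forms on a representation `ρ`. -/
def invariantForms (ρ : Representation R G V) (H : Set G) : Submodule R (V →ₗ[R] R) where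
  carrier := {φ | ∀ g ∈ H, ∀ v : V, φ (ρ g v) = φ v}
  add_mem' := by
    intro φ ψ hφ hψ g hg v
    simp only [LinearMap.add_apply, hφ g hg v, hψ g hg v]
  zero_mem' := by intro g hg v; simp
  smul_mem' := by
    intro c φ hφ g hg v
    simp only [LinearMap.smul_apply, hφ g hg v]

/-- A representation is irreducible if it is nonzero and its only invariant submodules
are `⊥` and `⊤`. -/
def IsIrreducibleRep (ρ : Representation R G V) : Prop :=
  (⊥ : Submodule R V) ≠ ⊤ ∧
    ∀ W : Submodule R V, (∀ g : G, ∀ v ∈ W, ρ g v ∈ W) → W = ⊥ ∨ W = ⊤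

/-- Two representations are isomorphic if there is an equivariant linear equivalence. -/
def RepIso {W : Type} [AddCommGroup W] [Module R W]
    (ρ : Representation R G V) (τ : Representation R G W) : Prop :=
  ∃ e : V ≃ₗ[R] W, ∀ (g : G) (v : V), e (ρ g v) = τ g (e v)

/-- `ρ` is (isomorphic to) a subquotient of `τ`:  there is a `τ`-invariant submodule `q`
together with an equivariant surjection from `q` onto the space of `ρ`. -/
def IsSubquotientOf {W : Type} [AddCommGroup W] [Module R W]
    (ρ : Representation R G V) (τ : Representation R G W) : Prop :=
  ∃ (q : Submodule R W) (hq : ∀ g : G, ∀ w ∈ q, τ g w ∈ q) (f : ↥q →ₗ[R] V),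
    Function.Surjective f ∧
      ∀ (g : G) (w : ↥q), f ⟨τ g w.1, hq g w.1 w.2⟩ = ρ g (f w)

end InvariantForms
section Cuspidal

variable (k : Type) [Field k]

/-- A representation of `GL n k` is cuspidal if it has no nonzero vector invariant under the
unipotent radical of a proper (maximal) parabolic subgroup. -/
def IsCuspidal {R : Type} [CommRing R] {n : ℕ} {V : Type} [AddCommGroup V] [Module R V]
    (ρ : Representation R (GL (Fin n) k) V) : Prop :=
  ∀ a b : ℕ, 0 < a → 0 < b → a + b = n →
    ∀ v : V,
      (∀ g : GL (Fin n) k,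
        (∀ i j : Fin n, ¬((i : ℕ) < a ∧ a ≤ (j : ℕ)) →
          (g : Matrix (Fin n) (Fin n) k) i j = (1 : Matrix (Fin n) (Fin n) k) i j) →
        ρ g v = v) → v = 0

end Cuspidal
section Levi

variable (k : Type) [Field k]

lemma levi_mem_iff {n r : ℕ} (B : Fin n → Fin r) (M : Matrix (Fin n) (Fin n) k) :
    (∀ i j, B i ≠ B j → M i j = 0) ↔
      (Matrix.BlockTriangular M B ∧ Matrix.BlockTriangular M (OrderDual.toDual ∘ B)) := by
  constructor
  · intro h
    refine ⟨fun i j hij => h i j (ne_of_gt hij), fun i j hij => h i j (ne_of_lt ?_)⟩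
    exact OrderDual.toDual_lt_toDual.mp hij
  · rintro ⟨h₁, h₂⟩ i j hij
    rcases lt_or_gt_of_ne hij with hlt | hgt
    · exact h₂ (by simpa using hlt)
    · exact h₁ hgt

/-- The block-diagonal Levi subgroup of `GL n k` attached to a block function `B`. -/
def levi (n r : ℕ) (B : Fin n → Fin r) : Subgroup (GL (Fin n) k) where
  carrier := {g | ∀ i j, B i ≠ B j → (g : Matrix (Fin n) (Fin n) k) i j = 0}
  one_mem' := by
    intro i j hij
    have hne : i ≠ j := fun h => hij (by rw [h])
    simp [Matrix.one_apply, hne]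
  mul_mem' := by
    intro a b ha hb
    have h : ((a * b : GL (Fin n) k) : Matrix (Fin n) (Fin n) k)
        = (a : Matrix (Fin n) (Fin n) k) * (b : Matrix (Fin n) (Fin n) k) := rfl
    rw [Set.mem_setOf_eq] at ha hb ⊢
    rw [levi_mem_iff] at ha hb ⊢
    rw [h]
    exact ⟨ha.1.mul hb.1, ha.2.mul hb.2⟩
  inv_mem' := by
    intro a ha
    have h : ((a⁻¹ : GL (Fin n) k) : Matrix (Fin n) (Fin n) k)
        = (a : Matrix (Fin n) (Fin n) k)⁻¹ := by
      simp [Matrix.coe_units_inv]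
    rw [Set.mem_setOf_eq] at ha ⊢
    rw [levi_mem_iff] at ha ⊢
    rw [h]
    haveI : Invertible (a : Matrix (Fin n) (Fin n) k) := a.invertible
    exact ⟨Matrix.blockTriangular_inv_of_blockTriangular ha.1,
      Matrix.blockTriangular_inv_of_blockTriangular ha.2⟩

end Levi
/-- The block function on `Fin n` describing two consecutive blocks, the first of size `r`. -/
def twoBlocks (n r : ℕ) : Fin n → Fin 2 := fun i => if (i : ℕ) < r then 0 else 1

/-- The transvection `1 + x ⊗ y` attached to a vector `x` and a linear form `y` killing it. -/
def shear {K ι : Type*} [Field K] [Fintype ι] [DecidableEq ι] (x y : ι → K) (h : y ⬝ᵥ x = 0) :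
    GL ι K where
  val := 1 + vecMulVec x y
  inv := 1 - vecMulVec x y
  val_inv := by
    simp [mul_sub, add_mul, vecMulVec_mul_vecMulVec, h]
  inv_val := by
    simp [mul_add, sub_mul, vecMulVec_mul_vecMulVec, h]

lemma shear_mul_shear {K ι : Type*} [Field K] [Fintype ι] [DecidableEq ι] (x y z : ι → K)
    (hy : y ⬝ᵥ x = 0) (hz : z ⬝ᵥ x = 0) (hyz : (y + z) ⬝ᵥ x = 0) :
    shear x y hy * shear x z hz = shear x (y + z) hyz := by
  ext1
  simp [shear, mul_add, add_mul, vecMulVec_mul_vecMulVec, hy, vecMulVec_add, add_assoc]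

/-- Block upper-triangular unipotent matrices with two diagonal blocks. -/
def upperUnipotent {K S T : Type*} [Field K] [Fintype S] [DecidableEq S] [Fintype T]
    [DecidableEq T] (X : Matrix T S K) : GL (T ⊕ S) K where
  val := fromBlocks 1 X 0 1
  inv := fromBlocks 1 (-X) 0 1
  val_inv := by simp [fromBlocks_multiply]
  inv_val := by simp [fromBlocks_multiply]

lemma exists_GL_mulVec_eq {K ι : Type*} [Field K] [Fintype ι] [DecidableEq ι] (x y : ι → K)
    (hx : x ≠ 0) (hy : y ≠ 0) : ∃ P : GL ι K, (P : Matrix ι ι K) *ᵥ x = y := by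
  let f := (LinearEquiv.toSpanNonzeroSingleton K (ι → K) x hx).symm ≪≫ₗ
    LinearEquiv.toSpanNonzeroSingleton K (ι → K) y hy
  obtain ⟨g, hg⟩ := Submodule.exists_linearEquiv_restrict_eq f
  refine ⟨Matrix.GeneralLinearGroup.toLin.symm
    (LinearMap.GeneralLinearGroup.ofLinearEquiv g), ?_⟩
  have h1 := hg ⟨x, Submodule.mem_span_singleton_self x⟩
  have h2 : f ⟨x, Submodule.mem_span_singleton_self x⟩
      = ⟨y, Submodule.mem_span_singleton_self y⟩ := by
    have : (⟨x, Submodule.mem_span_singleton_self x⟩ : Submodule.span K {x})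
      = LinearEquiv.toSpanNonzeroSingleton K (ι → K) x hx 1 := by
      ext1; simp
    rw [this]
    simp only [f, LinearEquiv.trans_apply, LinearEquiv.symm_apply_apply]
    ext1; simp
  rw [h2] at h1
  rw [← Matrix.toLin'_apply]
  have : Matrix.toLin' (↑(Matrix.GeneralLinearGroup.toLin.symm
    (LinearMap.GeneralLinearGroup.ofLinearEquiv g)) : Matrix ι ι K) =
      (g : (ι → K) →ₗ[K] (ι → K)) := by
    have := congrArg Units.val (Matrix.GeneralLinearGroup.toLin.apply_symm_apply
      (LinearMap.GeneralLinearGroup.ofLinearEquiv g))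
    exact this
  rw [this]
  simpa using h1.symm

lemma exists_addChar_ne_one (K R : Type*) [Field K] [Finite K] [Field R] [IsAlgClosed R]
    (h : ringChar R ≠ ringChar K) : ∃ ψ : AddChar K R, ψ ≠ 1 := by
  let ψ := AddChar.FiniteField.primitiveChar K R h
  have hn : ψ.char ≠ 1 := by
    intro h1
    apply ψ.prim (one_ne_zero)
    simp [h1]
  obtain ⟨a, ha⟩ := AddChar.ne_one_iff.1 hn
  have : FiniteDimensional R (CyclotomicField ψ.n R) :=
    inferInstanceAs (FiniteDimensional R (Polynomial.cyclotomic ψ.n R).SplittingField)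
  let j : CyclotomicField ψ.n R →ₐ[R] R := IsAlgClosed.lift
  refine ⟨(j : CyclotomicField ψ.n R →* R).compAddChar ψ.char, AddChar.ne_one_iff.2 ⟨a, ?_⟩⟩
  intro h1
  apply ha
  apply j.toRingHom.injective
  simpa using h1

section Distinction

variable {K R V : Type*} [Field K] [Fintype K] [Field R] [AddCommGroup V] [Module R V]

/-- A linear form invariant under the transvections along a fixed vector vanishes, when no
nonzero vector is invariant under them. -/
lemma eq_zero_of_forall_shear {ι : Type*} [Fintype ι] [DecidableEq ι] (hK : (Fintype.card K : R) ≠ 0)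
    (ρ : Representation R (GL ι K) V) (x : ι → K)
    (hx : ∀ v : V, (∀ y h, ρ (shear x y h) v = v) → v = 0)
    (φ : V →ₗ[R] R) (hφ : ∀ y h v, φ (ρ (shear x y h) v) = φ v) : φ = 0 := by
  classical
  let W : Submodule K (ι → K) := LinearMap.ker (dotProductBilin K K x)
  have hW (y : W) : y.1 ⬝ᵥ x = 0 := by
    rw [dotProduct_comm]
    exact LinearMap.mem_ker.1 y.2
  ext v
  have hv : ∑ y : W, ρ (shear x y.1 (hW y)) v = 0 := by
    refine hx _ fun z hz => ?_
    have hzW : z ∈ W := by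
      rw [dotProduct_comm] at hz
      exact LinearMap.mem_ker.2 hz
    rw [map_sum]
    refine Fintype.sum_equiv (Equiv.addLeft (⟨z, hzW⟩ : W)) _ _ fun y => ?_
    rw [← Module.End.mul_apply, ← map_mul,
      shear_mul_shear x z y.1 hz (hW y) (hW (⟨z, hzW⟩ + y))]
    rfl
  have h := congrArg φ hv
  simp only [map_sum, hφ, Finset.sum_const, Finset.card_univ, map_zero, nsmul_eq_mul] at h
  have hc : (Fintype.card W : R) ≠ 0 := by
    rw [Module.card_eq_pow_finrank (K := K) (V := W)]
    push_cast
    exact pow_ne_zero _ hK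
  simpa [hc] using h

/-- Let `ψ` be a nontrivial additive character and let the first block be the larger one. A form
invariant under the transvections of the first block is a sum of eigenforms for the block unipotent
group, each of them invariant under all transvections along some vector of the first block. -/
lemma eq_zero_of_forall_block_shear {S T : Type*} [Fintype S] [DecidableEq S] [Fintype T]
    [DecidableEq T] (hST : Fintype.card S < Fintype.card T) (hK : (Fintype.card K : R) ≠ 0)
    (ψ : AddChar K R) (hψ : ψ ≠ 1) (ρ : Representation R (GL (T ⊕ S) K) V)
    (hρ : ∀ x : T ⊕ S → K, x ≠ 0 → ∀ v : V, (∀ y h, ρ (shear x y h) v = v) → v = 0)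
    (φ : V →ₗ[R] R)
    (hφ : ∀ (x y : T → K) h v,
      φ (ρ (shear (Sum.elim x (0 : S → K)) (Sum.elim y (0 : S → K)) h) v) = φ v) :
    φ = 0 := by
  classical
  let F (A : Matrix S T K) : V →ₗ[R] R :=
    ∑ X : Matrix T S K, ψ (A * X).trace • (φ ∘ₗ ρ (upperUnipotent X))
  have hFapp (A : Matrix S T K) (v : V) :
      F A v = ∑ X : Matrix T S K, ψ (A * X).trace * φ (ρ (upperUnipotent X) v) := by
    simp [F]
  have hF (A : Matrix S T K) : F A = 0 := by
    obtain ⟨x, hx, hAx⟩ : ∃ x : T → K, x ≠ 0 ∧ A *ᵥ x = 0 := by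
      have h : LinearMap.ker A.mulVecLin ≠ ⊥ :=
        LinearMap.ker_ne_bot_of_finrank_lt (by simpa using hST)
      obtain ⟨x, hx, hx0⟩ := Submodule.exists_mem_ne_zero_of_ne_bot h
      exact ⟨x, hx0, hx⟩
    refine eq_zero_of_forall_shear hK ρ (Sum.elim x 0)
      (hρ _ fun h => hx (funext fun i => congrFun h (Sum.inl i))) _ fun y hy v => ?_
    have hy' : (Sum.elim (y ∘ Sum.inl) (0 : S → K)) ⬝ᵥ Sum.elim x (0 : S → K) = 0 := by
      rw [← hy]
      simp [dotProduct]
    let Y : Matrix T S K := vecMulVec x (y ∘ Sum.inr)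
    let N : Matrix T T K := vecMulVec x (y ∘ Sum.inl)
    have hyx : (y ∘ Sum.inl) ⬝ᵥ x = 0 := by simpa [dotProduct] using hy
    have hNN : N * N = 0 := by simp [N, vecMulVec_zero, vecMulVec_mul_vecMulVec, hyx]
    have hNY : N * Y = 0 := by
      simp only [N, Y, vecMulVec_mul_vecMulVec, hyx, zero_smul]
      ext
      simp [vecMulVec_apply]
    have hAN : A * N = 0 := by simp [N, mul_vecMulVec, hAx]
    have hAY : A * Y = 0 := by simp [Y, mul_vecMulVec, hAx]
    have hcomm (X : Matrix T S K) :
        upperUnipotent (X + N * X - Y) * shear (Sum.elim x 0) y hy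
          = shear (Sum.elim x 0) (Sum.elim (y ∘ Sum.inl) 0) hy' * upperUnipotent X := by
      have h1 : vecMulVec (Sum.elim x (0 : S → K)) y = fromBlocks N Y 0 0 := by
        ext (i | i) (j | j) <;> simp [N, Y, vecMulVec_apply]
      have h2 : vecMulVec (Sum.elim x (0 : S → K)) (Sum.elim (y ∘ Sum.inl) (0 : S → K))
          = fromBlocks N 0 0 0 := by
        ext (i | i) (j | j) <;> simp [N, vecMulVec_apply]
      ext1
      simp [upperUnipotent, shear, h1, h2, Matrix.mul_add, Matrix.add_mul, fromBlocks_multiply,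
        fromBlocks_add, ← fromBlocks_one]
    let e : Matrix T S K ≃ Matrix T S K :=
      { toFun := fun X => X + N * X - Y
        invFun := fun X => X - N * X + Y
        left_inv := fun X => by
          simp [Matrix.mul_add, Matrix.mul_sub, ← Matrix.mul_assoc, hNN, hNY]
          abel
        right_inv := fun X => by
          simp [Matrix.mul_add, Matrix.mul_sub, ← Matrix.mul_assoc, hNN, hNY]
          abel }
    rw [hFapp, hFapp]
    refine (Fintype.sum_equiv e _ _ fun X => ?_).symm
    have hφX := hφ x (y ∘ Sum.inl) hy' (ρ (upperUnipotent X) v)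
    rw [← Module.End.mul_apply, ← map_mul, ← hcomm] at hφX
    rw [← Module.End.mul_apply, ← map_mul, ← hφX]
    congr 3
    simp [e, Matrix.mul_add, Matrix.mul_sub, ← Matrix.mul_assoc, hAN, hAY]
  have hsum (X : Matrix T S K) (hX : X ≠ 0) : ∑ A : Matrix S T K, ψ (A * X).trace = 0 := by
    obtain ⟨i, j, hij⟩ : ∃ i j, X i j ≠ 0 := by
      by_contra! h
      exact hX (by ext i j; exact h i j)
    let tr : Matrix S T K →+ K :=
      { toFun := fun A => (A * X).trace
        map_zero' := by simp
        map_add' := fun A B => by simp [Matrix.add_mul] }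
    obtain ⟨a, ha⟩ := AddChar.ne_one_iff.1 hψ
    have h : ψ.compAddMonoidHom tr ≠ 1 := by
      refine AddChar.ne_one_iff.2 ⟨Matrix.single j i (a / X i j), ?_⟩
      have : tr (Matrix.single j i (a / X i j)) = a := by
        simp [tr, Matrix.trace_single_mul, hij]
      rwa [AddChar.compAddMonoidHom_apply, this]
    exact AddChar.sum_eq_zero_of_ne_one h
  ext v
  have h : ∑ A : Matrix S T K, F A v = 0 := by simp [hF]
  simp_rw [hFapp] at h
  rw [Finset.sum_comm] at h
  simp_rw [← Finset.sum_mul] at h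
  rw [Finset.sum_eq_single 0 (fun X _ hX => by rw [hsum X hX, zero_mul]) (by simp)] at h
  have hone : upperUnipotent (0 : Matrix T S K) = 1 := by
    ext1
    simp [upperUnipotent]
  have hc : (Fintype.card (Matrix S T K) : R) ≠ 0 := by
    rw [Module.card_eq_pow_finrank (K := K) (V := Matrix S T K)]
    push_cast
    exact pow_ne_zero _ hK
  simpa [hone, hc] using h

end Distinction

lemma shear_mul_comm {K ι : Type*} [Field K] [Fintype ι] [DecidableEq ι] (x y z : ι → K)
    (hy : y ⬝ᵥ x = 0) (hz : z ⬝ᵥ x = 1) (P : GL ι K) (hP : P.val = 1 + vecMulVec x z) :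
    P * shear x y hy = shear x y hy * shear x y hy * P := by
  ext1
  simp [shear, hP, mul_add, add_mul, vecMulVec_mul_vecMulVec, hy, hz, vecMulVec_zero]
  abel

/-- A form transforming by a character of a Levi subgroup is invariant under the transvections
supported in one block, in characteristic different from `2`. -/
lemma apply_shear_of_levi_equivariant {K R V : Type} [Field K] [Field R]
    [AddCommGroup V] [Module R V] (h2 : (2 : K) ≠ 0) {n : ℕ} (B : Fin n → Fin 2)
    (ρ : Representation R (GL (Fin n) K) V) (χ : levi K n 2 B →* R) (φ : V →ₗ[R] R)
    (hφ : ∀ (m : levi K n 2 B) (v : V), φ (ρ m v) = χ m * φ v) (c : Fin 2) (x y : Fin n → K)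
    (hx : ∀ i, B i ≠ c → x i = 0) (hy : ∀ i, B i ≠ c → y i = 0) (h : y ⬝ᵥ x = 0) (v : V) :
    φ (ρ (shear x y h) v) = φ v := by
  have hoff (w : Fin n → K) (hw : ∀ i, B i ≠ c → w i = 0) (i j : Fin n) (hij : B i ≠ B j) :
      (1 + vecMulVec x w) i j = 0 := by
    have hne : i ≠ j := fun h => hij (by rw [h])
    simp only [Matrix.add_apply, one_apply_ne hne, vecMulVec_apply, zero_add]
    by_cases hi : B i = c
    · rw [hw j (fun hj => hij (hi.trans hj.symm)), mul_zero]
    · rw [hx i hi, zero_mul]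
  by_cases hx0 : x = 0
  · have : shear x y h = 1 := by
      ext1
      simp [shear, hx0]
    simp [this]
  obtain ⟨i, hi⟩ := Function.ne_iff.1 hx0
  have hic : B i = c := by
    by_contra hne
    exact hi (hx i hne)
  let z : Fin n → K := Pi.single i (x i)⁻¹
  have hz : z ⬝ᵥ x = 1 := by
    simpa [z] using inv_mul_cancel₀ hi
  have hzc (j : Fin n) (hj : B j ≠ c) : z j = 0 := by
    have : j ≠ i := fun h => hj (h ▸ hic)
    simp [z, this]
  have hinv : (2 : K)⁻¹ + (2 : K)⁻¹ = 1 := by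
    field_simp
    norm_num
  let P : GL (Fin n) K :=
    { val := 1 + vecMulVec x z
      inv := 1 - (2 : K)⁻¹ • vecMulVec x z
      val_inv := by
        simp [mul_sub, add_mul, vecMulVec_mul_vecMulVec, hz]
        rw [← add_smul, hinv]
        simp
      inv_val := by
        simp [mul_add, sub_mul, vecMulVec_mul_vecMulVec, hz]
        rw [sub_add_sub_comm, ← add_smul, hinv]
        simp }
  let g : levi K n 2 B := ⟨shear x y h, hoff y hy⟩
  let q : levi K n 2 B := ⟨P, hoff z hzc⟩
  have hqg : q * g = g * g * q := Subtype.ext (shear_mul_comm x y z h hz P rfl)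
  have hg : χ g = 1 := by
    have hq0 : χ q ≠ 0 := ((Group.isUnit q).map χ).ne_zero
    have hg0 : χ g ≠ 0 := ((Group.isUnit g).map χ).ne_zero
    have := congrArg χ hqg
    simp only [map_mul] at this
    exact mul_left_cancel₀ (mul_ne_zero hg0 hq0)
      (show χ g * χ q * χ g = χ g * χ q * 1 by linear_combination -this)
  have := hφ g v
  rwa [hg, one_mul] at this

/-- In a cuspidal representation, the transvections along a fixed nonzero vector have no
nonzero common fixed vector. -/
lemma IsCuspidal.eq_zero_of_forall_shear {K R V : Type} [Field K] [Field R]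
    [AddCommGroup V] [Module R V] {n : ℕ} (hn : 2 ≤ n)
    {ρ : Representation R (GL (Fin n) K) V} (hρ : IsCuspidal K ρ) {x : Fin n → K} (hx : x ≠ 0)
    {v : V} (hv : ∀ y h, ρ (shear x y h) v = v) : v = 0 := by
  have : NeZero n := ⟨by omega⟩
  obtain ⟨P, hP⟩ := exists_GL_mulVec_eq (Pi.single (0 : Fin n) (1 : K)) x (by simp) hx
  have h0 : ρ P⁻¹ v = 0 := by
    refine hρ 1 (n - 1) one_pos (by omega) (by omega) _ fun g hg => ?_
    let l : Fin n → K := fun j => if j = 0 then 0 else g.val 0 j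
    have hgl : g.val = 1 + vecMulVec (Pi.single 0 1) l := by
      ext i j
      by_cases hij : (i : ℕ) < 1 ∧ 1 ≤ (j : ℕ)
      · obtain rfl : i = 0 := Fin.ext (by simpa using hij.1)
        have hj : j ≠ 0 := by
          rintro rfl
          simp at hij
        simp [l, vecMulVec_apply, hj, one_apply_ne hj.symm]
      · rw [hg i j hij]
        by_cases hi : i = 0
        · subst hi
          have hj : j = 0 := Fin.ext (by simp at hij ⊢; omega)
          subst hj
          simp [l, vecMulVec_apply]
        · simp [vecMulVec_apply, hi]
    have hlP : (l ᵥ* (P⁻¹).val) ᵥ* P.val = l := by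
      rw [vecMul_vecMul, ← Units.val_mul]
      simp
    have hyx : (l ᵥ* (P⁻¹).val) ⬝ᵥ x = 0 := by
      rw [← hP, dotProduct_mulVec, hlP]
      simp [l]
    have hPg : g * P⁻¹ = P⁻¹ * shear x (l ᵥ* (P⁻¹).val) hyx := by
      rw [mul_inv_eq_iff_eq_mul, mul_assoc, eq_inv_mul_iff_mul_eq]
      ext1
      simp only [Units.val_mul, hgl, shear, mul_add, add_mul, mul_vecMulVec, vecMulVec_mul, hP,
        hlP, mul_one, one_mul]
    rw [← Module.End.mul_apply, ← map_mul, hPg, map_mul, Module.End.mul_apply, hv]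
  have := congrArg (ρ P) h0
  simpa [← Module.End.mul_apply, ← map_mul] using this

/-- Reindexing of general linear groups along a bijection. -/
def reindexGL (K : Type*) {ι κ : Type*} [Field K] [Fintype ι] [DecidableEq ι] [Fintype κ]
    [DecidableEq κ] (e : ι ≃ κ) : GL ι K →* GL κ K :=
  Units.map (reindexAlgEquiv K K e : Matrix ι ι K →* Matrix κ κ K)

lemma reindexGL_shear {K ι κ : Type*} [Field K] [Fintype ι] [DecidableEq ι] [Fintype κ]
    [DecidableEq κ] (e : ι ≃ κ) (x y : ι → K) (h : y ⬝ᵥ x = 0)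
    (h' : (y ∘ e.symm) ⬝ᵥ (x ∘ e.symm) = 0) :
    reindexGL K e (shear x y h) = shear (x ∘ e.symm) (y ∘ e.symm) h' := by
  ext i j
  simp [reindexGL, shear, vecMulVec_apply, one_apply]

/-- If a cuspidal representation is distinguished by a character of a block-diagonal subgroup with
two blocks, neither block is larger than the other. -/
lemma card_block_le_of_levi_equivariant {K R V : Type} [Field K] [Fintype K] [Field R]
    [IsAlgClosed R] (h2 : (2 : K) ≠ 0) (hRK : ringChar R ≠ ringChar K)
    [AddCommGroup V] [Module R V] {n : ℕ} (hn : 2 ≤ n) (B : Fin n → Fin 2)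
    (ρ : Representation R (GL (Fin n) K) V) (hρ : IsCuspidal K ρ) (χ : levi K n 2 B →* R)
    (φ : V →ₗ[R] R) (hφ0 : φ ≠ 0)
    (hφ : ∀ (m : levi K n 2 B) (v : V), φ (ρ m v) = χ m * φ v) (c : Fin 2) :
    Fintype.card {i // B i = c} ≤ Fintype.card {i // ¬ B i = c} := by
  by_contra! hlt
  apply hφ0
  have hK : (Fintype.card K : R) ≠ 0 := by
    obtain ⟨m, hp, hm⟩ := FiniteField.card K (ringChar K)
    rw [hm]
    push_cast
    refine pow_ne_zero _ fun h0 => ?_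
    have hd := ringChar.dvd h0
    rcases CharP.char_is_prime_or_zero R (ringChar R) with hq | hq
    · exact hRK ((Nat.prime_dvd_prime_iff_eq hq hp).1 hd)
    · rw [hq, zero_dvd_iff] at hd
      exact hp.ne_zero hd
  obtain ⟨ψ, hψ⟩ := exists_addChar_ne_one K R hRK
  let e := Equiv.sumCompl (fun i => B i = c)
  refine eq_zero_of_forall_block_shear hlt hK ψ hψ (ρ.comp (reindexGL K e)) ?_ φ ?_
  · intro x hx v hv
    have hx' : x ∘ e.symm ≠ 0 := fun h => hx (by
      ext i
      simpa using congrFun h (e i))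
    refine hρ.eq_zero_of_forall_shear hn hx' fun y h => ?_
    have h' : (y ∘ e) ⬝ᵥ x = 0 := by
      rw [← h]
      exact Fintype.sum_equiv e _ _ fun i => by simp
    have hy : (y ∘ e) ∘ e.symm = y := by
      ext i
      simp
    have := hv (y ∘ e) h'
    rw [MonoidHom.comp_apply, reindexGL_shear e x (y ∘ e) h' (by rwa [hy])] at this
    simpa only [hy] using this
  · intro x y h v
    have h' : (Sum.elim y (0 : {i // ¬ B i = c} → K) ∘ e.symm) ⬝ᵥ
        (Sum.elim x (0 : {i // ¬ B i = c} → K) ∘ e.symm) = 0 := by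
      rw [← h]
      exact Fintype.sum_equiv e.symm _ _ fun i => by simp
    have hsupp (x : {i // B i = c} → K) (i : Fin n) (hi : B i ≠ c) :
        (Sum.elim x (0 : {i // ¬ B i = c} → K) ∘ e.symm) i = 0 := by
      simp [e, Equiv.sumCompl_symm_apply_of_neg (p := fun i => B i = c) hi]
    rw [MonoidHom.comp_apply, reindexGL_shear e _ _ h h']
    exact apply_shear_of_levi_equivariant h2 B ρ χ φ hφ c _ _ (hsupp x) (hsupp y) h' v

lemma card_twoBlocks_eq_zero {n r : ℕ} (h : r ≤ n) :
    Fintype.card {i // twoBlocks n r i = 0} = r := by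
  simp [twoBlocks, Fintype.card_subtype, Fin.card_filter_val_lt, h]

lemma card_twoBlocks_eq_one {n r : ℕ} (h : r ≤ n) :
    Fintype.card {i // twoBlocks n r i = 1} = n - r := by
  have h0 := Fintype.card_subtype_compl (fun i => twoBlocks n r i = 0)
  rw [card_twoBlocks_eq_zero h, Fintype.card_fin] at h0
  rw [← h0]
  refine Fintype.card_congr (Equiv.subtypeEquivRight fun i => ?_)
  simp [twoBlocks]

/-- A cuspidal irreducible representation of `GL n k` (`p ≠ 2`) distinguished
by a character of the maximal Levi subgroup `GL r × GL s` forces `r = s`. -/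
theorem cuspidal_distinguished_by_levi_character
    (p : ℕ) [Fact p.Prime] (hp : p ≠ 2)
    (k : Type) [Field k] [Fintype k] [CharP k p]
    (R : Type) [Field R] [IsAlgClosed R] (hchar : ringChar R ≠ p)
    (n r s : ℕ) (hn : 2 ≤ n) (hrs : r + s = n)
    (V : Type) [AddCommGroup V] [Module R V]
    (ρ : Representation R (GL (Fin n) k) V)
    (hirr : IsIrreducibleRep ρ) (hcusp : IsCuspidal k ρ)
    (χ : ↥(levi k n 2 (twoBlocks n r)) →* R)
    (φ : V →ₗ[R] R) (hφ : φ ≠ 0)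
    (hrel : ∀ (m : ↥(levi k n 2 (twoBlocks n r))) (v : V), φ (ρ (↑m) v) = χ m * φ v) :
    r = s := by
  have hk : ringChar k = p := ringChar.eq_iff.2 inferInstance
  have h2 : (2 : k) ≠ 0 := Ring.two_ne_zero (by rwa [hk])
  have hcard := card_block_le_of_levi_equivariant h2 (by rwa [hk]) hn _ ρ hcusp χ φ hφ hrel
  have h0 := hcard 0
  have h1 := hcard 1
  rw [Fintype.card_subtype_compl, card_twoBlocks_eq_zero (by omega), Fintype.card_fin] at h0
  rw [Fintype.card_subtype_compl, card_twoBlocks_eq_one (by omega), Fintype.card_fin] at h1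
  omega
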